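/- Let σ > 0 and consider the sampling process with parameters (F = 0, D = 1/2, σ²). Then the probability that two adjacent output bits agree satisfies p_e = Pr(z_1 = z_2) ≤ 1 − (1/2)·tanh(πσ). -/

import Mathlib

open MeasureTheory ProbabilityTheory Real Set

/-- The noise step measure: Gaussian with mean `F` and variance `v`. -/
noncomputable def stepGauss (F v : ℝ) : Measure ℝ := gaussianReal F v.toNNReal

/-- Finite-window probability space for the sampling process: an initial phase,
uniform on `[0,1)`, together with `n` i.i.d. Gaussian increments of mean `F`
and variance `v`. -/
noncomputable def procMeasure (F v : ℝ) (n : ℕ) : Measure (ℝ × (Fin n → ℝ)) :=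
  (volume.restrict (Set.Ico (0:ℝ) 1)).prod (Measure.pi fun _ : Fin n => stepGauss F v)

/-- The phase `x_j` of the sampling process: initial phase plus the first `j`
Gaussian increments, reduced mod 1. -/
noncomputable def phase {n : ℕ} (ω : ℝ × (Fin n → ℝ)) (j : ℕ) : ℝ :=
  Int.fract (ω.1 + ∑ i : Fin n, if (i : ℕ) < j then ω.2 i else 0)

/-- Output bit of the sampler at phase `x`: `1` iff `x < D`. -/
noncomputable def bit (D x : ℝ) : Bool := decide (x < D)

/-- Probability that the output bits `z_1, …, z_n` of the sampling process with
parameters `(F, D, v)` form exactly the pattern `z`. -/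
noncomputable def patternProb (F D v : ℝ) (n : ℕ) (z : Fin n → Bool) : ℝ :=
  (procMeasure F v n {ω | ∀ j : Fin n, bit D (phase ω ((j : ℕ) + 1)) = z j}).toReal

/-- Probability that `z_i = z_{i+k}` in the sampling process with parameters `(F, D, v)`. -/
noncomputable def agreeProb (F D v : ℝ) (i k : ℕ) : ℝ :=
  (procMeasure F v (i + k) {ω | bit D (phase ω i) = bit D (phase ω (i + k))}).toReal

/-- The wrapped Gaussian step density `f_s` with frequency `F` and variance `v`. -/
noncomputable def stepDensity (F v : ℝ) (x : ℝ) : ℝ :=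
  (1 / Real.sqrt (2 * Real.pi * v)) * ∑' i : ℤ, Real.exp (-(x - F + (i : ℝ))^2 / (2 * v))


/-! ### The triangle wave -/

/-- The triangle wave `t ↦ |1 - 2 {t}|`: the probability that two phases at offset `t` lie in the
same half of the circle. -/
noncomputable def triangleWave (t : ℝ) : ℝ := |1 - 2 * Int.fract t|

lemma measurable_triangleWave : Measurable triangleWave := by
  unfold triangleWave
  fun_prop

lemma triangleWave_nonneg (t : ℝ) : 0 ≤ triangleWave t := abs_nonneg _

lemma triangleWave_le_one (t : ℝ) : triangleWave t ≤ 1 := by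
  have h0 := Int.fract_nonneg t
  have h1 := (Int.fract_lt_one t).le
  rw [triangleWave, abs_le]
  constructor <;> linarith

lemma triangleWave_neg (t : ℝ) : triangleWave (-t) = triangleWave t := by
  by_cases h : Int.fract t = 0
  · simp [triangleWave, h, Int.fract_neg_eq_zero.mpr h]
  · rw [triangleWave, triangleWave, Int.fract_neg h, ← abs_neg]
    congr 1
    ring

lemma triangleWave_abs (t : ℝ) : triangleWave |t| = triangleWave t := by
  rcases abs_choice t with h | h <;> rw [h]
  exact triangleWave_neg t

lemma triangleWave_le_quartic (t : ℝ) :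
    triangleWave t ≤ 1 - 2 * |t| + 27 / 8 * t ^ 4 := by
  rw [← triangleWave_abs, ← (show Even 4 by decide).pow_abs t]
  have hs : 0 ≤ |t| := abs_nonneg t
  set s := |t|
  rcases lt_or_ge s 1 with h | h
  · rw [triangleWave, Int.fract_eq_self.mpr ⟨hs, h⟩, abs_le]
    constructor
    · nlinarith [sq_nonneg (s ^ 2 - 4 / 9), sq_nonneg (s - 2 / 3)]
    · nlinarith [pow_nonneg hs 4]
  · refine (triangleWave_le_one s).trans ?_
    have : 1 ≤ s ^ 3 := one_le_pow₀ h
    nlinarith [mul_le_mul_of_nonneg_left this hs]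

lemma hasSum_triangleWave (t : ℝ) :
    HasSum (fun n : ℕ => 8 / π ^ 2 * (1 / ((2 * n + 1 : ℕ) : ℝ) ^ 2 *
      cos (2 * π * (2 * n + 1 : ℕ) * t))) (2 * triangleWave t - 1) := by
  have key : ∀ x ∈ Icc (0 : ℝ) (1 / 2), HasSum (fun n : ℕ => 8 / π ^ 2 *
      (1 / ((2 * n + 1 : ℕ) : ℝ) ^ 2 * cos (2 * π * (2 * n + 1 : ℕ) * x))) (1 - 4 * x) := by
    intro x hx
    have hB : ∀ y : ℝ, (-1 : ℝ) ^ (1 + 1) * (2 * π) ^ (2 * 1) / 2 / ((2 * 1).factorial : ℝ) *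
        (Polynomial.map (algebraMap ℚ ℝ) (Polynomial.bernoulli (2 * 1))).eval y
        = π ^ 2 * (y ^ 2 - y + 1 / 6) := by
      intro y
      simp [Polynomial.bernoulli_def, Finset.sum_range_succ, Polynomial.eval_monomial,
        bernoulli_eq_bernoulli'_of_ne_one, bernoulli_one, Nat.factorial]
      ring_nf
    have h1 := hasSum_one_div_nat_pow_mul_cos one_ne_zero (x := x) ⟨hx.1, by linarith [hx.2]⟩
    have h2 := (hasSum_one_div_nat_pow_mul_cos one_ne_zero (x := 2 * x)
      ⟨by linarith [hx.1], by linarith [hx.2]⟩).mul_left (1 / 4)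
    rw [hB, mul_one] at h1 h2
    have hodd : Summable fun n : ℕ => 1 / ((2 * n + 1 : ℕ) : ℝ) ^ 2 *
        cos (2 * π * (2 * n + 1 : ℕ) * x) :=
      h1.summable.comp_injective (i := fun n : ℕ => 2 * n + 1) fun a b h => by simpa using h
    have h3 : HasSum (fun n : ℕ => 1 / ((2 * n : ℕ) : ℝ) ^ 2 * cos (2 * π * (2 * n : ℕ) * x))
        (1 / 4 * (π ^ 2 * ((2 * x) ^ 2 - 2 * x + 1 / 6))) := by
      convert! h2 using 2 with n
      rw [show 2 * π * (2 * n : ℕ) * x = 2 * π * n * (2 * x) by push_cast; ring]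
      push_cast
      ring
    have h4 := (HasSum.even_add_odd (f := fun n : ℕ => 1 / (n : ℝ) ^ 2 * cos (2 * π * n * x))
      h3 hodd.hasSum).unique h1
    have h5 := hodd.hasSum.mul_left (8 / π ^ 2)
    rw [eq_sub_of_add_eq' h4] at h5
    rwa [show 8 / π ^ 2 * (π ^ 2 * (x ^ 2 - x + 1 / 6) - 1 / 4 * (π ^ 2 * ((2 * x) ^ 2 - 2 * x + 1 / 6)))
        = 1 - 4 * x by field_simp; ring] at h5
  have hper : ∀ n : ℕ, cos (2 * π * (2 * n + 1 : ℕ) * t)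
      = cos (2 * π * (2 * n + 1 : ℕ) * Int.fract t) := by
    intro n
    rw [Int.fract, ← cos_sub_int_mul_two_pi _ ((2 * n + 1 : ℕ) * ⌊t⌋)]
    congr 1
    push_cast
    ring
  have hrefl : ∀ n : ℕ, cos (2 * π * (2 * n + 1 : ℕ) * Int.fract t)
      = cos (2 * π * (2 * n + 1 : ℕ) * (1 - Int.fract t)) := by
    intro n
    rw [← cos_nat_mul_two_pi_sub _ (2 * n + 1)]
    congr 1
    ring
  simp_rw [hper]
  have h0 := Int.fract_nonneg t
  have h1 := (Int.fract_lt_one t).le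
  unfold triangleWave
  rcases le_total (Int.fract t) (1 / 2) with h | h
  · rw [abs_of_nonneg (by linarith),
      show 2 * (1 - 2 * Int.fract t) - 1 = 1 - 4 * Int.fract t by ring]
    exact key _ ⟨h0, h⟩
  · rw [abs_of_nonpos (by linarith),
      show 2 * -(1 - 2 * Int.fract t) - 1 = 1 - 4 * (1 - Int.fract t) by ring]
    simp_rw [hrefl]
    exact key _ ⟨by linarith, by linarith⟩

/-! ### Elementary inequalities for `tanh` -/

lemma hasDerivAt_tanh (x : ℝ) : HasDerivAt tanh (1 - tanh x ^ 2) x := by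
  have := (hasDerivAt_sinh x).div (hasDerivAt_cosh x) (cosh_pos x).ne'
  rw [show tanh = fun y => sinh y / cosh y from funext tanh_eq_sinh_div_cosh]
  refine this.congr_deriv ?_
  have := (cosh_pos x).ne'
  beta_reduce
  field_simp

lemma tanh_nonneg {x : ℝ} (hx : 0 ≤ x) : 0 ≤ tanh x := by
  rw [tanh_eq_sinh_div_cosh]
  exact div_nonneg (sinh_nonneg_iff.mpr hx) (cosh_pos x).le

lemma nonneg_of_hasDerivAt_nonneg {f f' : ℝ → ℝ} {b x : ℝ} (hf : ∀ y, HasDerivAt f (f' y) y)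
    (hf' : ∀ y, 0 ≤ y → y ≤ b → 0 ≤ f' y) (h0 : f 0 = 0) (hx : 0 ≤ x) (hxb : x ≤ b) :
    0 ≤ f x := by
  have hmono : MonotoneOn f (Icc 0 b) := by
    refine monotoneOn_of_deriv_nonneg (convex_Icc 0 b)
      (fun y _ => (hf y).continuousAt.continuousWithinAt)
      (fun y _ => (hf y).differentiableAt.differentiableWithinAt) fun y hy => ?_
    rw [interior_Icc] at hy
    rw [(hf y).deriv]
    exact hf' y hy.1.le hy.2.le
  have := hmono (left_mem_Icc.mpr (hx.trans hxb)) ⟨hx, hxb⟩ hx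
  rwa [h0] at this

lemma tanh_le_self {x : ℝ} (hx : 0 ≤ x) : tanh x ≤ x := by
  have := nonneg_of_hasDerivAt_nonneg (f := fun y => y - tanh y) (b := x)
    (fun y => (hasDerivAt_id y).sub (hasDerivAt_tanh y))
    (fun y _ _ => by nlinarith [sq_nonneg (tanh y)]) (by simp) hx le_rfl
  linarith

lemma sub_cube_le_tanh {x : ℝ} (hx : 0 ≤ x) : x - x ^ 3 / 3 ≤ tanh x := by
  have := nonneg_of_hasDerivAt_nonneg (f := fun y => tanh y - (y - y ^ 3 / 3)) (b := x)
    (fun y => (hasDerivAt_tanh y).sub ((hasDerivAt_id y).sub ((hasDerivAt_pow 3 y).div_const 3)))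
    (fun y h _ => by
      have := pow_le_pow_left₀ (tanh_nonneg h) (tanh_le_self h) 2
      norm_num
      linarith) (by simp) hx le_rfl
  linarith

lemma tanh_le_taylor {x : ℝ} (hx : 0 ≤ x) (hx1 : x ≤ 1) :
    tanh x ≤ x - x ^ 3 / 3 + 2 * x ^ 5 / 15 - x ^ 7 / 63 := by
  have := nonneg_of_hasDerivAt_nonneg
    (f := fun y => y - y ^ 3 / 3 + 2 * y ^ 5 / 15 - y ^ 7 / 63 - tanh y) (b := 1)
    (fun y => (((((hasDerivAt_id y).sub ((hasDerivAt_pow 3 y).div_const 3)).add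
      (((hasDerivAt_pow 5 y).const_mul 2).div_const 15)).sub
      ((hasDerivAt_pow 7 y).div_const 63)).sub (hasDerivAt_tanh y)))
    (fun y h h1 => by
      have hy : 0 ≤ y - y ^ 3 / 3 := by nlinarith [pow_le_one₀ (n := 2) h h1]
      have := pow_le_pow_left₀ hy (sub_cube_le_tanh h) 2
      norm_num
      nlinarith) (by simp) hx hx1
  linarith

lemma tanh_le_sub_quartic {u : ℝ} (hu : 0 ≤ u) (hu1 : u ≤ 1) :
    tanh u ≤ u - 81 / 4 / π ^ 4 * u ^ 4 := by
  have hπ : 81 / 4 / π ^ 4 ≤ 21 / 100 := by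
    have h : (3.14 : ℝ) ^ 4 ≤ π ^ 4 := pow_le_pow_left₀ (by norm_num) pi_gt_d2.le 4
    rw [div_le_iff₀ (by positivity)]
    norm_num at h ⊢
    linarith
  have h4 := mul_le_mul_of_nonneg_right hπ (pow_nonneg hu 4)
  have h := tanh_le_taylor hu hu1
  have hfac : 0 ≤ 1 / 3 - 2 * u ^ 2 / 15 + u ^ 4 / 63 - 21 / 100 * u := by
    nlinarith [pow_nonneg hu 2, pow_nonneg hu 3, mul_nonneg hu (sub_nonneg.mpr hu1), sq_nonneg (u^2-1)]
  nlinarith [mul_nonneg (pow_nonneg hu 3) hfac]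

lemma exp_neg_two_mul_sq_le {u : ℝ} (hu : 1 ≤ u) : exp (-(2 * u ^ 2)) ≤ 1 - tanh u := by
  have h1 : exp (-(2 * u ^ 2)) ≤ exp (-(2 * u)) := exp_le_exp.mpr (by nlinarith)
  refine h1.trans ?_
  rw [tanh_eq, show -(2 * u) = -u + -u by ring, exp_add]
  have ha : 0 < exp u := exp_pos u
  have hb : 0 < exp (-u) := exp_pos _
  have hab : exp u * exp (-u) = 1 := by rw [← exp_add]; simp
  have hb1 : exp (-u) ≤ 1 := exp_le_one_iff.mpr (by linarith)
  rw [one_sub_div (by positivity), le_div_iff₀ (by positivity)]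
  nlinarith [mul_pos hb hb]

/-! ### Gaussian integrals -/

lemma integral_cos_gaussianReal (s : ℝ) (v : NNReal) :
    ∫ t, cos (s * t) ∂gaussianReal 0 v = exp (-(v * s ^ 2 / 2)) := by
  have h := congrArg Complex.re (charFun_gaussianReal (μ := 0) (v := v) s)
  rw [charFun_apply_real] at h
  have hInt : Integrable (fun t : ℝ => Complex.exp (s * t * Complex.I)) (gaussianReal 0 v) := by
    refine (integrable_const (1 : ℝ)).mono (by fun_prop) (ae_of_all _ fun t => ?_)
    rw [← Complex.ofReal_mul, Complex.norm_exp_ofReal_mul_I]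
    simp
  have hre := integral_re hInt
  simp only [RCLike.re_to_complex] at hre
  rw [← hre] at h
  simp_rw [← Complex.ofReal_mul, Complex.exp_ofReal_mul_I_re] at h
  rw [h, ← Complex.exp_ofReal_re]
  congr 2
  push_cast
  ring

lemma integral_abs_pow_gaussianReal (n : ℕ) :
    ∫ t, |t| ^ n ∂gaussianReal 0 1
      = (√(2 * π))⁻¹ * ((1 / 2 : ℝ) ^ (-(n + 1 : ℝ) / 2) * Gamma ((n + 1 : ℝ) / 2)) := by
  have hI := integral_rpow_mul_exp_neg_mul_rpow (p := 2) (q := n) (b := 1 / 2) (by norm_num)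
    (by linarith [n.cast_nonneg (α := ℝ)]) (by norm_num)
  rw [integral_gaussianReal_eq_integral_smul one_ne_zero]
  have h : ∀ t : ℝ, gaussianPDFReal 0 1 t • |t| ^ n
      = (fun x : ℝ => (√(2 * π))⁻¹ * (x ^ (n : ℝ) * exp (-(1 / 2) * x ^ (2 : ℝ)))) |t| := by
    intro t
    simp only [gaussianPDFReal, rpow_natCast, rpow_two, sq_abs, smul_eq_mul]
    norm_num
    ring_nf
  rw [integral_congr_ae (ae_of_all _ h), integral_comp_abs
    (f := fun x : ℝ => (√(2 * π))⁻¹ * (x ^ (n : ℝ) * exp (-(1 / 2) * x ^ (2 : ℝ)))),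
    integral_const_mul, hI]
  ring

lemma integral_abs_gaussianReal : ∫ t, |t| ∂gaussianReal 0 1 = √(2 / π) := by
  have h := integral_abs_pow_gaussianReal 1
  simp only [pow_one] at h
  rw [h, show (((1 : ℕ) : ℝ) + 1) / 2 = 1 by norm_num, Gamma_one,
    show -(((1 : ℕ) : ℝ) + 1) / 2 = -1 by norm_num, rpow_neg_one, sqrt_div zero_le_two,
    sqrt_mul zero_le_two]
  field_simp
  norm_num

lemma integral_pow_four_gaussianReal : ∫ t, t ^ 4 ∂gaussianReal 0 1 = 3 := by
  have h := integral_abs_pow_gaussianReal 4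
  simp only [(show Even 4 by decide).pow_abs] at h
  have hpow : (1 / 2 : ℝ) ^ (-(5 / 2) : ℝ) = 4 * √2 := by
    rw [one_div, inv_rpow zero_le_two, rpow_neg zero_le_two, inv_inv,
      show (5 / 2 : ℝ) = 2 + 1 / 2 by norm_num, rpow_add two_pos, ← sqrt_eq_rpow]
    norm_num
  have hGamma : Gamma (5 / 2) = 3 / 4 * √π := by
    rw [show (5 / 2 : ℝ) = 1 / 2 + 1 + 1 by norm_num, Gamma_add_one (by norm_num),
      Gamma_add_one (by norm_num), Gamma_one_half_eq]
    ring
  rw [h, show (((4 : ℕ) : ℝ) + 1) / 2 = 5 / 2 by norm_num, hGamma,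
    show -(((4 : ℕ) : ℝ) + 1) / 2 = -(5 / 2) by norm_num, hpow, sqrt_mul zero_le_two]
  field_simp

lemma integrable_triangleWave (μ : Measure ℝ) [IsFiniteMeasure μ] : Integrable triangleWave μ :=
  (integrable_const (1 : ℝ)).mono measurable_triangleWave.aestronglyMeasurable
    (ae_of_all _ fun t => by
      simpa [abs_of_nonneg (triangleWave_nonneg t)] using triangleWave_le_one t)

lemma integral_triangleWave_le_quartic {σ : ℝ} (hσ : 0 < σ) :
    ∫ t, triangleWave t ∂gaussianReal 0 (σ ^ 2).toNNReal
      ≤ 1 - π * σ / 2 + 81 / 8 * σ ^ 4 := by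
  have hmap : gaussianReal 0 (σ ^ 2).toNNReal = (gaussianReal 0 1).map (σ * ·) := by
    rw [gaussianReal_map_const_mul]
    congr 1
    · simp
    · ext
      simp [sq_nonneg]
  have habs : Integrable (fun t : ℝ => |t|) (gaussianReal 0 1) := by
    have := (memLp_id_gaussianReal (μ := 0) (v := 1) 1).integrable le_rfl
    exact this.abs
  have hfour : Integrable (fun t : ℝ => t ^ 4) (gaussianReal 0 1) := by
    have := (memLp_id_gaussianReal (μ := 0) (v := 1) 4).integrable_norm_pow (by norm_num)
    simpa [(show Even 4 by decide).pow_abs] using this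
  have hπ : π / 4 ≤ √(2 / π) := by
    apply le_sqrt_of_sq_le
    rw [le_div_iff₀ pi_pos]
    have := pow_le_pow_left₀ pi_pos.le pi_lt_d2.le 3
    norm_num at this
    linarith
  rw [hmap, integral_map (by fun_prop) measurable_triangleWave.aestronglyMeasurable]
  calc ∫ t, triangleWave (σ * t) ∂gaussianReal 0 1
      ≤ ∫ t, (1 - 2 * σ * |t| + 27 / 8 * σ ^ 4 * t ^ 4) ∂gaussianReal 0 1 := by
        refine integral_mono ?_ ?_ fun t => ?_
        · exact (integrable_map_measure measurable_triangleWave.aestronglyMeasurable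
            (by fun_prop)).mp (integrable_triangleWave _)
        · exact ((integrable_const _).sub (habs.const_mul _)).add (hfour.const_mul _)
        · refine (triangleWave_le_quartic _).trans_eq ?_
          rw [abs_mul, abs_of_pos hσ]
          ring
    _ = 1 - 2 * σ * √(2 / π) + 27 / 8 * σ ^ 4 * 3 := by
        have hsub : Integrable (fun t : ℝ => 1 - 2 * σ * |t|) (gaussianReal 0 1) :=
          (integrable_const _).sub (habs.const_mul _)
        rw [integral_add hsub (hfour.const_mul _), integral_sub (integrable_const _) (habs.const_mul _), integral_const_mul,
          integral_const_mul, integral_abs_gaussianReal, integral_pow_four_gaussianReal]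
        simp
    _ ≤ 1 - π * σ / 2 + 81 / 8 * σ ^ 4 := by nlinarith

lemma integral_triangleWave_le_exp (σ : ℝ) :
    2 * ∫ t, triangleWave t ∂gaussianReal 0 (σ ^ 2).toNNReal - 1
      ≤ exp (-(2 * (π * σ) ^ 2)) := by
  set μ := gaussianReal 0 (σ ^ 2).toNNReal
  have hcoef : HasSum (fun n : ℕ => 8 / π ^ 2 * (1 / ((2 * n + 1 : ℕ) : ℝ) ^ 2)) 1 := by
    have := hasSum_triangleWave 0
    norm_num [triangleWave] at this ⊢
    exact this
  have hInt : ∀ n : ℕ, ∫ t, 8 / π ^ 2 * (1 / ((2 * n + 1 : ℕ) : ℝ) ^ 2 *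
      cos (2 * π * (2 * n + 1 : ℕ) * t)) ∂μ
      = 8 / π ^ 2 * (1 / ((2 * n + 1 : ℕ) : ℝ) ^ 2) *
        exp (-(2 * (π * σ) ^ 2 * ((2 * n + 1 : ℕ) : ℝ) ^ 2)) := by
    intro n
    rw [integral_const_mul, integral_const_mul, integral_cos_gaussianReal,
      Real.coe_toNNReal _ (sq_nonneg σ)]
    ring_nf
  have hsum : HasSum (fun n : ℕ => ∫ t, 8 / π ^ 2 * (1 / ((2 * n + 1 : ℕ) : ℝ) ^ 2 *
      cos (2 * π * (2 * n + 1 : ℕ) * t)) ∂μ) (∫ t, (2 * triangleWave t - 1) ∂μ) := by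
    refine hasSum_integral_of_dominated_convergence
      (fun n _ => 8 / π ^ 2 * (1 / ((2 * n + 1 : ℕ) : ℝ) ^ 2)) (fun n => by fun_prop)
      (fun n => ae_of_all _ fun t => ?_) (ae_of_all _ fun _ => hcoef.summable)
      (integrable_const _) (ae_of_all _ hasSum_triangleWave)
    rw [← mul_assoc, norm_mul, norm_of_nonneg (by positivity)]
    exact mul_le_of_le_one_right (by positivity) (abs_cos_le_one _)
  simp_rw [hInt] at hsum
  rw [integral_sub ((integrable_triangleWave μ).const_mul 2) (integrable_const _),
    integral_const_mul] at hsum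
  simp only [integral_const, probReal_univ, smul_eq_mul, mul_one] at hsum
  rw [← one_mul (exp _)]
  refine hasSum_le (fun n => ?_) hsum (hcoef.mul_right _)
  have hn : (1 : ℝ) ≤ ((2 * n + 1 : ℕ) : ℝ) := by exact_mod_cast Nat.le_add_left 1 (2 * n)
  refine mul_le_mul_of_nonneg_left (exp_le_exp.mpr (neg_le_neg ?_)) (by positivity)
  exact le_mul_of_one_le_right (by positivity) (one_le_pow₀ hn)

lemma integral_triangleWave_le_tanh {σ : ℝ} (hσ : 0 < σ) :
    ∫ t, triangleWave t ∂gaussianReal 0 (σ ^ 2).toNNReal ≤ 1 - 1 / 2 * tanh (π * σ) := by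
  have hu : 0 ≤ π * σ := by positivity
  rcases le_total (π * σ) 1 with h | h
  · have h1 := integral_triangleWave_le_quartic hσ
    have h2 := tanh_le_sub_quartic hu h
    have h3 : 81 / 4 / π ^ 4 * (π * σ) ^ 4 = 81 / 4 * σ ^ 4 := by
      field_simp
    linarith
  · linarith [integral_triangleWave_le_exp σ, exp_neg_two_mul_sq_le h]

/-! ### Reduction of the agreement probability to a Gaussian integral -/

lemma bit_eq_bit_iff (x y : ℝ) : bit (1 / 2) x = bit (1 / 2) y ↔ (x < 1 / 2 ↔ y < 1 / 2) := by
  simp [bit]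

lemma measurable_bit (D : ℝ) : Measurable (bit D) :=
  measurable_to_bool (by
    have : bit D ⁻¹' {true} = Iio D := by ext; simp [bit]
    rw [this]
    exact measurableSet_Iio)

/-- The initial points for which an offset of `t` does not change the half of the circle. -/
def agreeSet (t : ℝ) : Set ℝ := {x | bit (1 / 2) (Int.fract x) = bit (1 / 2) (Int.fract (x + t))}

lemma measurableSet_agreeSet (t : ℝ) : MeasurableSet (agreeSet t) :=
  measurableSet_eq_fun ((measurable_bit _).comp measurable_fract)
    ((measurable_bit _).comp (measurable_fract.comp (measurable_add_const t)))

lemma volume_agreeSet_le (t : ℝ) :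
    volume.restrict (Ico (0 : ℝ) 1) (agreeSet t) ≤ ENNReal.ofReal (triangleWave t) := by
  rw [Measure.restrict_apply (measurableSet_agreeSet t)]
  set r := Int.fract t with hr
  have hr0 : 0 ≤ r := Int.fract_nonneg t
  have hr1 : r < 1 := Int.fract_lt_one t
  have hfr : ∀ x, Int.fract (x + t) = Int.fract (x + r) := fun x => by
    rw [hr, Int.fract_eq_fract]
    exact ⟨⌊t⌋, by linarith [Int.floor_add_fract t]⟩
  have hcase : ∀ x ∈ agreeSet t ∩ Ico 0 1, (x < 1 / 2 ↔ Int.fract (x + r) < 1 / 2) := by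
    rintro x ⟨hx, hx01⟩
    rw [agreeSet, mem_ofPred_eq, bit_eq_bit_iff, Int.fract_eq_self.mpr hx01, hfr] at hx
    exact hx
  have hlow : ∀ x ∈ Ico (0 : ℝ) 1, x + r < 1 → Int.fract (x + r) = x + r := fun x hx h =>
    Int.fract_eq_self.mpr ⟨by linarith [hx.1], h⟩
  have hhigh : ∀ x ∈ Ico (0 : ℝ) 1, 1 ≤ x + r → Int.fract (x + r) = x + r - 1 := fun x hx h => by
    rw [← Int.fract_sub_one, Int.fract_eq_self]
    exact ⟨by linarith, by linarith [hx.2]⟩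
  have hU : ∀ a b c d : ℝ, a ≤ b → c ≤ d → b - a + (d - c) ≤ triangleWave t →
      agreeSet t ∩ Ico 0 1 ⊆ Ico a b ∪ Ico c d →
      volume (agreeSet t ∩ Ico 0 1) ≤ ENNReal.ofReal (triangleWave t) := by
    intro a b c d hab hcd h hsub
    refine (measure_mono hsub).trans ((measure_union_le _ _).trans ?_)
    rw [Real.volume_Ico, Real.volume_Ico, ← ENNReal.ofReal_add (by linarith) (by linarith)]
    exact ENNReal.ofReal_le_ofReal h
  rcases le_total r (1 / 2) with h | h
  · refine hU 0 (1 / 2 - r) (1 / 2) (1 - r) (by linarith) (by linarith) ?_ fun x hx => ?_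
    · rw [triangleWave, abs_of_nonneg (by linarith)]
      linarith
    · have hc := hcase x hx
      rcases lt_or_ge (x + r) 1 with h1 | h1
      · rw [hlow x hx.2 h1] at hc
        grind
      · rw [hhigh x hx.2 h1] at hc
        grind
  · refine hU (1 - r) (1 / 2) (3 / 2 - r) 1 (by linarith) (by linarith) ?_ fun x hx => ?_
    · rw [triangleWave, abs_of_nonpos (by linarith)]
      linarith
    · have hc := hcase x hx
      rcases lt_or_ge (x + r) 1 with h1 | h1
      · rw [hlow x hx.2 h1] at hc
        grind
      · rw [hhigh x hx.2 h1] at hc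
        grind

lemma volume_preimage_add_agreeSet_le (a t : ℝ) :
    volume.restrict (Ico (0 : ℝ) 1) ((· + a) ⁻¹' agreeSet t) ≤ ENNReal.ofReal (triangleWave t) := by
  refine le_of_eq_of_le ?_ (volume_agreeSet_le t)
  have hper : Function.Periodic ((agreeSet t).indicator (1 : ℝ → ℝ)) 1 := by
    intro x
    have : x + 1 ∈ agreeSet t ↔ x ∈ agreeSet t := by
      simp [agreeSet, add_right_comm x 1 t]
    by_cases h : x ∈ agreeSet t <;> simp [h, this]
  have hmeas := measurableSet_agreeSet t
  have hreal : ∀ s : Set ℝ, MeasurableSet s → (volume.restrict (Ico (0 : ℝ) 1)).real s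
      = ∫ x in (0 : ℝ)..1, s.indicator (1 : ℝ → ℝ) x := fun s hs => by
    rw [intervalIntegral.integral_of_le zero_le_one, ← integral_Ico_eq_integral_Ioc,
      integral_indicator_one hs]
  have hpre : MeasurableSet ((· + a) ⁻¹' agreeSet t) := measurable_add_const a hmeas
  rw [← measureReal_eq_measureReal_iff, hreal _ hpre, hreal _ hmeas]
  have := intervalIntegral.integral_comp_add_right (a := 0) (b := 1)
    ((agreeSet t).indicator (1 : ℝ → ℝ)) a
  have h2 := hper.intervalIntegral_add_eq a 0
  rw [zero_add, add_comm 1 a, h2, zero_add] at this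
  exact this

lemma agreeProb_one_one_le (F v : ℝ) :
    agreeProb F (1 / 2) v 1 1 ≤ ∫ t, triangleWave t ∂gaussianReal F v.toNNReal := by
  have : IsProbabilityMeasure (stepGauss F v) := by unfold stepGauss; infer_instance
  have hphase : ∀ j : ℕ, Measurable fun ω : ℝ × (Fin (1 + 1) → ℝ) => phase ω j := by
    intro j
    unfold phase
    refine measurable_fract.comp (measurable_fst.add (Finset.measurable_sum _ fun i _ => ?_))
    split_ifs <;> fun_prop
  have hS : MeasurableSet {ω : ℝ × (Fin (1 + 1) → ℝ) |
      bit (1 / 2) (phase ω 1) = bit (1 / 2) (phase ω (1 + 1))} :=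
    measurableSet_eq_fun ((measurable_bit _).comp (hphase _)) ((measurable_bit _).comp (hphase _))
  have hfiber : ∀ y : Fin (1 + 1) → ℝ, (fun x => (x, y)) ⁻¹' {ω : ℝ × (Fin (1 + 1) → ℝ) |
      bit (1 / 2) (phase ω 1) = bit (1 / 2) (phase ω (1 + 1))}
      = (· + y 0) ⁻¹' agreeSet (y 1) := by
    intro y
    ext x
    simp [phase, agreeSet, Fin.sum_univ_two, add_assoc]
  rw [agreeProb, procMeasure, Measure.prod_apply_symm hS]
  refine ENNReal.toReal_le_of_le_ofReal (integral_nonneg triangleWave_nonneg) ?_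
  simp_rw [hfiber]
  calc _ ≤ ∫⁻ y, ENNReal.ofReal (triangleWave (y 1))
        ∂Measure.pi fun _ : Fin (1 + 1) => stepGauss F v :=
        lintegral_mono fun y => volume_preimage_add_agreeSet_le _ _
    _ = ∫⁻ t, ENNReal.ofReal (triangleWave t) ∂stepGauss F v :=
        (measurePreserving_eval (fun _ : Fin (1 + 1) => stepGauss F v) 1).lintegral_comp
          measurable_triangleWave.ennreal_ofReal
    _ = _ := (ofReal_integral_eq_lintegral_ofReal (integrable_triangleWave _)
        (ae_of_all _ triangleWave_nonneg)).symm

/-- For `σ > 0` and the sampling process with parameters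
`(F = 0, D = 1/2, σ²)`, the probability that two adjacent output bits agree
satisfies `p_e = Pr(z_1 = z_2) ≤ 1 − (1/2)·tanh(πσ)`. -/
theorem pe_tanh_bound (σ : ℝ) (hσ : 0 < σ) :
    agreeProb 0 (1/2) (σ^2) 1 1 ≤ 1 - (1/2) * Real.tanh (Real.pi * σ) := by
  exact (agreeProb_one_one_le 0 (σ ^ 2)).trans (integral_triangleWave_le_tanh hσ)
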